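/- For all integers n ≥ 1 and j ≥ 0, the recurrence Q̃_{n,j} = Σ Q̃_{m,i} · h_{n−m} holds as formal power series in x_1, x_2, …, where the sum ranges over all pairs of integers (m,i) with 0 ≤ m ≤ n−2 and j + m − n < i < j. -/

import Mathlib

/-!
STATEMENT 8: For all n ≥ 1 and j ≥ 0, the recurrence
Q̃_{n,j} = Σ Q̃_{m,i} · h_{n−m}
holds as formal power series in x_1, x_2, …, where the sum ranges over all pairs of
integers (m,i) with 0 ≤ m ≤ n−2 and j + m − n < i < j.  (The condition
`j + m − n < i` over ℤ is rendered as `j + m < i + n` over ℕ.)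
-/

open scoped Classical

/-- The one-line value `σ(i)` of a permutation of `[n] = {1,…,n}` (1-based), extended
to all of `ℕ` by the identity outside `[n]`. -/
def pv {n : ℕ} (σ : Equiv.Perm (Fin n)) (i : ℕ) : ℕ :=
  if h : 1 ≤ i ∧ i ≤ n then ((σ ⟨i - 1, by omega⟩ : Fin n) : ℕ) + 1 else i

/-- The excedance set `Exc(σ) = {i ∈ [n-1] : σ(i) > i}`. -/
def ExcSet {n : ℕ} (σ : Equiv.Perm (Fin n)) : Finset ℕ :=
  (Finset.Icc 1 (n - 1)).filter fun i => i < pv σ i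

/-- The excedance number `exc(σ) = |Exc(σ)|`. -/
def exc {n : ℕ} (σ : Equiv.Perm (Fin n)) : ℕ := (ExcSet σ).card

/-- The excedance-descent set `Exd(σ) ⊆ [n-1]`: `i ∈ Exd(σ)` iff
(σ(i) ≤ i and σ(i+1) > i+1), or (σ(i) > i and σ(i+1) > i+1 and σ(i) > σ(i+1)),
or (σ(i) ≤ i and σ(i+1) ≤ i+1 and σ(i) > σ(i+1)). -/
def ExdSet {n : ℕ} (σ : Equiv.Perm (Fin n)) : Finset ℕ :=
  (Finset.Icc 1 (n - 1)).filter fun i =>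
    (pv σ i ≤ i ∧ i + 1 < pv σ (i + 1)) ∨
    (i < pv σ i ∧ i + 1 < pv σ (i + 1) ∧ pv σ (i + 1) < pv σ i) ∨
    (pv σ i ≤ i ∧ pv σ (i + 1) ≤ i + 1 ∧ pv σ (i + 1) < pv σ i)

/-- The ring of formal power series in countably many variables x_1, x_2, … over ℚ. -/
abbrev R : Type := MvPowerSeries ℕ+ ℚ

/-- The fundamental quasisymmetric function `F_{S,n}(x_1,x_2,…)`: its coefficient on the
monomial with exponent vector `d` is the number of sequences of positive integers
`i_1 ≥ ⋯ ≥ i_n` with `i_j > i_{j+1}` for all `j ∈ S` whose associated monomial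
`x_{i_1}⋯x_{i_n}` is `x^d` (the sequence is recorded as `f : Fin n → ℕ+`, with `f j` the
`(j+1)`-st entry `i_{j+1}`). -/
noncomputable def Fqs (n : ℕ) (S : Finset ℕ) : R := fun d =>
  (Nat.card {f : Fin n → ℕ+ //
    (∀ j : Fin n, ∀ hj : j.val + 1 < n,
      f ⟨j.val + 1, hj⟩ ≤ f j ∧ (j.val + 1 ∈ S → f ⟨j.val + 1, hj⟩ < f j)) ∧
    ∀ i : ℕ+, d i = (Finset.univ.filter fun j => f j = i).card} : ℚ)

/-- `Q_{n,j} = Σ F_{Exd(σ),n}` over permutations `σ ∈ S_n` with `exc(σ) = j`. -/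
noncomputable def Qsym (n j : ℕ) : R :=
  ∑ σ ∈ Finset.univ.filter (fun σ : Equiv.Perm (Fin n) => exc σ = j), Fqs n (ExdSet σ)

/-- The complete homogeneous symmetric function `h_n`: every monomial of total degree
`n` has coefficient `1`. -/
noncomputable def hSym (n : ℕ) : R := fun d => if (d.sum fun _ e => e) = n then 1 else 0

/-- `Q̃_{n,j} = Σ F_{Exd(σ),n}` over derangements `σ ∈ S_n` (permutations with no fixed
point) with `exc(σ) = j`.  (For `n = 0` this gives `Q̃_{0,0} = 1`, and `Q̃_{n,j} = 0`
whenever there is no such derangement.) -/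
noncomputable def Qtilde (n j : ℕ) : R :=
  ∑ σ ∈ Finset.univ.filter
      (fun σ : Equiv.Perm (Fin n) => (∀ i, σ i ≠ i) ∧ exc σ = j),
    Fqs n (ExdSet σ)

open Finset

/-- A product of `k` factors `L`, with `p` removed from the first factor and `q` removed from
the last one. -/
def endTrimmedPow {A : Type*} [CommRing A] (L p q : A) : ℕ → A
  | 0 => 1
  | 1 => L - p - q
  | k + 2 => (L - p) * L ^ k * (L - q)

theorem endTrimmedPow_swap {A : Type*} [CommRing A] (L p q : A) (k : ℕ) :
    endTrimmedPow L p q k = endTrimmedPow L q p k := by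
  rcases k with _ | _ | k <;> simp only [endTrimmedPow] <;> ring

theorem sum_antidiagonal_pow_mul_endTrimmedPow {A : Type*} [CommRing A] (L p q : A) (a : ℕ) :
    ∑ u ∈ antidiagonal (a + 1), q ^ u.1 * endTrimmedPow L p q u.2 = L ^ a * (L - p) := by
  induction a with
  | zero => rw [Nat.sum_antidiagonal_succ]; simp [endTrimmedPow]
  | succ a ih =>
    rw [Nat.sum_antidiagonal_succ]
    have h : ∀ u : ℕ × ℕ, q ^ (u.1 + 1) * endTrimmedPow L p q u.2 =
        q * (q ^ u.1 * endTrimmedPow L p q u.2) := fun u => by ring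
    simp only [h]
    rw [← mul_sum, ih]
    simp only [endTrimmedPow]
    ring

theorem prod_endTrimmed {A ι : Type*} [CommRing A] [LinearOrder ι] (L p q : A) (s : Finset ι) :
    ∏ v ∈ s, (L - (if ∃ u ∈ s, u < v then 0 else p) - (if ∃ u ∈ s, v < u then 0 else q)) =
      endTrimmedPow L p q s.card := by
  rcases s.eq_empty_or_nonempty with rfl | hs
  · simp [endTrimmedPow]
  rcases Nat.lt_or_ge 1 s.card with h1 | h1
  · have hlt := min'_lt_max'_of_card s h1
    obtain ⟨k, hk⟩ : ∃ k, s.card = k + 2 := ⟨s.card - 2, by omega⟩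
    have hmin := s.min'_mem hs
    have hmax := s.max'_mem hs
    have hmax' : s.max' hs ∈ s.erase (s.min' hs) := mem_erase.2 ⟨hlt.ne', hmax⟩
    rw [← mul_prod_erase _ _ hmin, ← mul_prod_erase _ _ hmax', hk]
    have hmid : ∀ v ∈ (s.erase (s.min' hs)).erase (s.max' hs),
        (L - (if ∃ u ∈ s, u < v then 0 else p) - (if ∃ u ∈ s, v < u then 0 else q)) = L := by
      intro v hv
      simp only [mem_erase] at hv
      rw [if_pos ⟨_, hmin, lt_of_le_of_ne (s.min'_le _ hv.2.2) (Ne.symm hv.2.1)⟩,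
        if_pos ⟨_, hmax, lt_of_le_of_ne (s.le_max' _ hv.2.2) hv.1⟩, sub_zero, sub_zero]
    rw [prod_congr rfl hmid, prod_const, card_erase_of_mem hmax', card_erase_of_mem hmin, hk,
      if_neg (fun ⟨u, hu, h⟩ => (s.min'_le u hu).not_gt h), if_pos ⟨_, hmax, hlt⟩,
      if_pos ⟨_, hmin, hlt⟩, if_neg (fun ⟨u, hu, h⟩ => (s.le_max' u hu).not_gt h)]
    simp only [endTrimmedPow, sub_zero, show k + 2 - 1 - 1 = k by omega]
    ring
  · obtain ⟨x, rfl⟩ := card_eq_one.1 (le_antisymm h1 hs.card_pos)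
    simp [endTrimmedPow]

theorem prod_telescope {A ι : Type*} [CommRing A] [LinearOrder ι] (t : A) (x : ι → A)
    (s : Finset ι) (p : A) :
    (∏ c ∈ s, (p + t * ∑ b ∈ s with c ≤ b, x b + ∑ b ∈ s with b < c, x b)) * (p + ∑ b ∈ s, x b) =
      (∏ c ∈ s, (p + t * ∑ b ∈ s with c < b, x b + ∑ b ∈ s with b ≤ c, x b)) *
        (p + t * ∑ b ∈ s, x b) := by
  induction s using Finset.induction_on_max generalizing p with
  | empty => simp
  | insert m s hm ih =>
    have hms : m ∉ s := fun h => (hm m h).false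
    have hle : ∀ c ∈ s, ¬ m ≤ c := fun c hc => (hm c hc).not_ge
    rw [prod_insert hms, prod_insert hms, sum_insert hms]
    have e1 : ∀ c ∈ s, p + t * ∑ b ∈ insert m s with c ≤ b, x b +
        ∑ b ∈ insert m s with b < c, x b =
        (p + t * x m) + t * ∑ b ∈ s with c ≤ b, x b + ∑ b ∈ s with b < c, x b := by
      intro c hc
      rw [filter_insert, if_pos (hm c hc).le, filter_insert, if_neg (hm c hc).not_gt,
        sum_insert (by simp [hms])]
      ring
    have e2 : ∀ c ∈ s, p + t * ∑ b ∈ insert m s with c < b, x b +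
        ∑ b ∈ insert m s with b ≤ c, x b =
        (p + t * x m) + t * ∑ b ∈ s with c < b, x b + ∑ b ∈ s with b ≤ c, x b := by
      intro c hc
      rw [filter_insert, if_pos (hm c hc), filter_insert, if_neg (hle c hc),
        sum_insert (by simp [hms])]
      ring
    rw [prod_congr rfl e1, prod_congr rfl e2]
    have f1 : ({b ∈ insert m s | m ≤ b} : Finset ι) = {m} := by
      ext b; simp only [mem_filter, mem_insert, mem_singleton]
      exact ⟨fun h => h.1.resolve_right fun hb => hle b hb h.2, by rintro rfl; simp⟩
    have f2 : ({b ∈ insert m s | b < m} : Finset ι) = s := by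
      ext b; simp only [mem_filter, mem_insert]
      exact ⟨fun h => h.1.resolve_left h.2.ne, fun h => ⟨Or.inr h, hm b h⟩⟩
    have f3 : ({b ∈ insert m s | m < b} : Finset ι) = ∅ := by
      ext b; simp only [mem_filter, mem_insert, notMem_empty, iff_false, not_and]
      rintro (rfl | hb)
      · simp
      · exact (hm b hb).not_gt
    have f4 : ({b ∈ insert m s | b ≤ m} : Finset ι) = insert m s := by
      ext b; simp only [mem_filter, mem_insert, and_iff_left_iff_imp]
      rintro (rfl | hb)
      · simp
      · exact (hm b hb).le
    rw [f1, f2, f3, f4, sum_insert hms, sum_singleton, sum_empty]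
    linear_combination (p + x m + ∑ b ∈ s, x b) * ih (p + t * x m)

theorem sum_antidiagonal_prod {A ι : Type*} [CommRing A] [DecidableEq ι] (d : ι →₀ ℕ)
    (φ : ι → ℕ → ℕ → A) :
    ∑ u ∈ antidiagonal d, ∏ c ∈ d.support, φ c (u.1 c) (u.2 c) =
      ∏ c ∈ d.support, ∑ u ∈ antidiagonal (d c), φ c u.1 u.2 := by
  rw [prod_sum]
  refine sum_bij' (fun u _ => fun c _ => (u.1 c, u.2 c))
    (fun g _ => (Finsupp.indicator d.support fun c hc => (g c hc).1,
      Finsupp.indicator d.support fun c hc => (g c hc).2)) ?_ ?_ ?_ ?_ ?_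
  · intro u hu
    simp only [mem_pi, HasAntidiagonal.mem_antidiagonal] at hu ⊢
    intro c _
    rw [← hu, Finsupp.add_apply]
  · intro g hg
    simp only [mem_pi, HasAntidiagonal.mem_antidiagonal] at hg ⊢
    ext c
    by_cases hc : c ∈ d.support
    · simpa [Finsupp.indicator_apply, hc, -Finsupp.mem_support_iff] using hg c hc
    · simpa [Finsupp.indicator_apply, hc, -Finsupp.mem_support_iff] using
        (Finsupp.notMem_support_iff.1 hc).symm
  · intro u hu
    rw [HasAntidiagonal.mem_antidiagonal] at hu
    have h0 : ∀ c, c ∉ d.support → u.1 c = 0 ∧ u.2 c = 0 := by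
      intro c hc
      rw [Finsupp.notMem_support_iff, ← hu, Finsupp.add_apply] at hc
      omega
    ext c <;> by_cases hc : c ∈ d.support <;>
      simp [Finsupp.indicator_apply, hc, h0 c, -Finsupp.mem_support_iff]
  · intro g hg
    funext c hc
    simp [Finsupp.indicator_apply, hc, -Finsupp.mem_support_iff]
  · intro u hu
    rw [← prod_attach]

open Polynomial in
/-- The variable marking excedances, as a constant of the polynomial ring in the `x_c`. -/
noncomputable def excVar : MvPolynomial ℕ+ ℚ[X] := MvPolynomial.C Polynomial.X

open Polynomial in
/-- The generating polynomial of all letters allowed in the interior of the block of `c`. -/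
noncomputable def letterForm (S : Finset ℕ+) (c : ℕ+) : MvPolynomial ℕ+ ℚ[X] :=
  excVar * ∑ b ∈ S with c ≤ b, MvPolynomial.X b + ∑ b ∈ S with b ≤ c, MvPolynomial.X b

open Polynomial in
/-- The generating polynomial of all words whose blocks have the lengths recorded by `e`. -/
noncomputable def blockPoly (S : Finset ℕ+) (e : ℕ+ →₀ ℕ) : MvPolynomial ℕ+ ℚ[X] :=
  ∏ c ∈ S, endTrimmedPow (letterForm S c) (excVar * MvPolynomial.X c) (MvPolynomial.X c) (e c)

theorem letterForm_sub_excVar_mul {S : Finset ℕ+} {c : ℕ+} (hc : c ∈ S) :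
    letterForm S c - excVar * MvPolynomial.X c =
      excVar * ∑ b ∈ S with c < b, MvPolynomial.X b + ∑ b ∈ S with b ≤ c, MvPolynomial.X b := by
  have h : ({b ∈ S | c ≤ b} : Finset ℕ+) = insert c {b ∈ S | c < b} := by
    ext b; simp only [mem_filter, mem_insert, le_iff_eq_or_lt]
    constructor
    · rintro ⟨hb, rfl | h⟩ <;> simp_all
    · rintro (rfl | h) <;> simp_all
  rw [letterForm, h, sum_insert (by simp)]
  ring

theorem letterForm_sub {S : Finset ℕ+} {c : ℕ+} (hc : c ∈ S) :
    letterForm S c - MvPolynomial.X c =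
      excVar * ∑ b ∈ S with c ≤ b, MvPolynomial.X b + ∑ b ∈ S with b < c, MvPolynomial.X b := by
  have h : ({b ∈ S | b ≤ c} : Finset ℕ+) = insert c {b ∈ S | b < c} := by
    ext b; simp only [mem_filter, mem_insert, le_iff_eq_or_lt]
    constructor
    · rintro ⟨hb, rfl | h⟩ <;> simp_all
    · rintro (rfl | h) <;> simp_all
  rw [letterForm, h, sum_insert (by simp)]
  ring

theorem prod_letterForm_sub {S : Finset ℕ+} (hS : S.Nonempty) :
    ∏ c ∈ S, (letterForm S c - MvPolynomial.X c) =
      excVar * ∏ c ∈ S, (letterForm S c - excVar * MvPolynomial.X c) := by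
  have h := prod_telescope excVar (fun b : ℕ+ => (MvPolynomial.X b : MvPolynomial ℕ+ _)) S 0
  simp only [zero_add] at h
  have hne : (∑ b ∈ S, MvPolynomial.X b : MvPolynomial ℕ+ (Polynomial ℚ)) ≠ 0 := by
    intro h0
    have := congrArg (MvPolynomial.eval fun _ => (1 : Polynomial ℚ)) h0
    simp [hS.ne_empty] at this
  apply mul_right_cancel₀ hne
  rw [prod_congr rfl fun c hc => letterForm_sub hc,
    prod_congr rfl fun c hc => letterForm_sub_excVar_mul hc, h]
  ring

theorem coeff_snd_of_antidiagonal {A : Type*} [CommRing A] (a : A) {d : ℕ+ →₀ ℕ}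
    {u : (ℕ+ →₀ ℕ) × (ℕ+ →₀ ℕ)} (hu : u ∈ antidiagonal d) (P : MvPolynomial ℕ+ A) :
    a ^ u.1.degree * P.coeff u.2 =
      ((∏ c ∈ d.support, (MvPolynomial.C a * MvPolynomial.X c) ^ u.1 c) * P).coeff d := by
  rw [HasAntidiagonal.mem_antidiagonal] at hu
  have hsub : u.1.support ⊆ d.support := Finsupp.support_mono (hu ▸ le_self_add)
  have hdeg : u.1.degree = ∑ c ∈ d.support, u.1 c := sum_subset hsub (by simp)
  have hm : ∏ c ∈ d.support, (MvPolynomial.C a * MvPolynomial.X c) ^ u.1 c =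
      MvPolynomial.monomial u.1 (a ^ u.1.degree) := by
    rw [MvPolynomial.monomial_eq, Finsupp.prod_of_support_subset _ hsub _ (by simp),
      hdeg, ← prod_pow_eq_pow_sum, map_prod,
      ← prod_mul_distrib]
    simp [mul_pow]
  rw [hm, ← hu, MvPolynomial.coeff_monomial_mul]

theorem sum_coeff_blockPoly {d : ℕ+ →₀ ℕ} (hd : d ≠ 0) :
    Polynomial.X * ∑ u ∈ antidiagonal d, (blockPoly d.support u.2).coeff u.2 =
      ∑ u ∈ antidiagonal d,
        Polynomial.X ^ u.1.degree * (blockPoly d.support u.2).coeff u.2 := by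
  have hpos : ∀ c ∈ d.support, ∃ a, d c = a + 1 := fun c hc =>
    ⟨d c - 1, by have := Finsupp.mem_support_iff.1 hc; omega⟩
  have h1 : ∀ u ∈ antidiagonal d, (blockPoly d.support u.2).coeff u.2 =
      (∏ c ∈ d.support, MvPolynomial.X c ^ u.1 c * endTrimmedPow (letterForm d.support c)
        (excVar * MvPolynomial.X c) (MvPolynomial.X c) (u.2 c)).coeff d := by
    intro u hu
    have := coeff_snd_of_antidiagonal 1 hu (blockPoly d.support u.2)
    rw [one_pow, one_mul] at this
    rw [this, blockPoly, ← prod_mul_distrib]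
    simp
  have h2 : ∀ u ∈ antidiagonal d,
      Polynomial.X ^ u.1.degree * (blockPoly d.support u.2).coeff u.2 =
      (∏ c ∈ d.support, (excVar * MvPolynomial.X c) ^ u.1 c *
        endTrimmedPow (letterForm d.support c)
        (excVar * MvPolynomial.X c) (MvPolynomial.X c) (u.2 c)).coeff d := by
    intro u hu
    rw [coeff_snd_of_antidiagonal _ hu, blockPoly, ← prod_mul_distrib]
    rfl
  rw [sum_congr rfl h1, sum_congr rfl h2, ← MvPolynomial.coeff_sum, ← MvPolynomial.coeff_sum,
    sum_antidiagonal_prod d fun c i k => MvPolynomial.X c ^ i *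
      endTrimmedPow (letterForm d.support c) (excVar * MvPolynomial.X c) (MvPolynomial.X c) k,
    sum_antidiagonal_prod d fun c i k => (excVar * MvPolynomial.X c) ^ i *
      endTrimmedPow (letterForm d.support c) (excVar * MvPolynomial.X c) (MvPolynomial.X c) k,
    ← MvPolynomial.coeff_C_mul]
  congr 1
  have e1 : ∀ c ∈ d.support, ∑ u ∈ antidiagonal (d c), MvPolynomial.X c ^ u.1 *
      endTrimmedPow (letterForm d.support c) (excVar * MvPolynomial.X c) (MvPolynomial.X c) u.2 =
      letterForm d.support c ^ (d c - 1) *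
        (letterForm d.support c - excVar * MvPolynomial.X c) := by
    intro c hc
    obtain ⟨a, ha⟩ := hpos c hc
    rw [ha, sum_antidiagonal_pow_mul_endTrimmedPow, Nat.add_sub_cancel]
  have e2 : ∀ c ∈ d.support, ∑ u ∈ antidiagonal (d c), (excVar * MvPolynomial.X c) ^ u.1 *
      endTrimmedPow (letterForm d.support c) (excVar * MvPolynomial.X c) (MvPolynomial.X c) u.2 =
      letterForm d.support c ^ (d c - 1) * (letterForm d.support c - MvPolynomial.X c) := by
    intro c hc
    obtain ⟨a, ha⟩ := hpos c hc
    simp only [endTrimmedPow_swap (letterForm d.support c) (excVar * MvPolynomial.X c)]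
    rw [ha, sum_antidiagonal_pow_mul_endTrimmedPow, Nat.add_sub_cancel]
  rw [prod_congr rfl e1, prod_congr rfl e2, prod_mul_distrib, prod_mul_distrib,
    prod_letterForm_sub (Finsupp.support_nonempty_iff.2 hd), excVar]
  ring

theorem coeff_blockPoly_recurrence {d : ℕ+ →₀ ℕ} (hd : d ≠ 0) :
    (blockPoly d.support d).coeff d =
      ∑ u ∈ antidiagonal d, (∑ k ∈ Ico 1 u.1.degree, Polynomial.X ^ k) *
        (blockPoly d.support u.2).coeff u.2 := by
  have hX : (1 - Polynomial.X : Polynomial ℚ) ≠ 0 := by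
    intro h
    simpa using congrArg (Polynomial.eval 0) h
  apply mul_left_cancel₀ hX
  have hgeom : ∀ m : ℕ, (1 - Polynomial.X : Polynomial ℚ) * ∑ k ∈ Ico 1 m, Polynomial.X ^ k =
      Polynomial.X - Polynomial.X ^ m + if m = 0 then 1 - Polynomial.X else 0 := by
    rintro (_ | m)
    · simp
    · rw [mul_comm, geom_sum_Ico_mul_neg _ (by omega)]
      simp
  have hterm : ∀ u ∈ antidiagonal d, (1 - Polynomial.X) *
      ((∑ k ∈ Ico 1 u.1.degree, Polynomial.X ^ k) * (blockPoly d.support u.2).coeff u.2) =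
      Polynomial.X * (blockPoly d.support u.2).coeff u.2 -
        Polynomial.X ^ u.1.degree * (blockPoly d.support u.2).coeff u.2 +
        if u = (0, d) then (1 - Polynomial.X) * (blockPoly d.support d).coeff d else 0 := by
    intro u hu
    rw [← mul_assoc, hgeom]
    have hiff : u.1.degree = 0 ↔ u = (0, d) := by
      rw [Finsupp.degree_eq_zero_iff, Prod.ext_iff]
      rw [HasAntidiagonal.mem_antidiagonal] at hu
      constructor
      · intro h; rw [h, zero_add] at hu; exact ⟨h, hu⟩
      · exact fun h => h.1
    by_cases h : u = (0, d)
    · subst h; simp; ring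
    · rw [if_neg (hiff.not.2 h), if_neg h]; ring
  rw [mul_sum, sum_congr rfl hterm, sum_add_distrib, sum_sub_distrib, ← mul_sum,
    sum_coeff_blockPoly hd, sub_self, zero_add, sum_ite_eq' _ (0, d), if_pos (by simp)]

/-- The exponent vector of the monomial of a sequence of positive integers. -/
noncomputable def content {n : ℕ} (f : Fin n → ℕ+) : ℕ+ →₀ ℕ := ∑ v, Finsupp.single (f v) 1

theorem content_apply {n : ℕ} (f : Fin n → ℕ+) (c : ℕ+) :
    content f c = #{v | f v = c} := by
  rw [content, Finsupp.finsetSum_apply, card_filter]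
  exact sum_congr rfl fun v _ => Finsupp.single_apply

theorem content_eq_iff {n : ℕ} (f : Fin n → ℕ+) (d : ℕ+ →₀ ℕ) :
    content f = d ↔ ∀ c, d c = #{v | f v = c} := by
  simp only [Finsupp.ext_iff, content_apply, eq_comm]

theorem mem_support_content {n : ℕ} (f : Fin n → ℕ+) (v : Fin n) : f v ∈ (content f).support := by
  rw [Finsupp.mem_support_iff, content_apply, ← Nat.pos_iff_ne_zero, card_pos]
  exact ⟨v, by simp⟩

theorem degree_content {n : ℕ} (f : Fin n → ℕ+) : (content f).degree = n := by
  simp [content]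

theorem content_comp_perm {n : ℕ} (f : Fin n → ℕ+) (σ : Equiv.Perm (Fin n)) :
    content (f ∘ σ) = content f :=
  Equiv.sum_comp σ fun v => Finsupp.single (f v) 1

/-- The letters allowed at position `v` of a word attached to the weakly decreasing sequence `f`.
A letter `(c, false)` comes from an excedance, a letter `(c, true)` from an anti-excedance. -/
def LetterAllowed {n : ℕ} (f : Fin n → ℕ+) (v : Fin n) (l : ℕ+ × Bool) : Prop :=
  (l.2 = false → f v ≤ l.1 ∧ (l.1 = f v → ∃ u, f u = f v ∧ u < v)) ∧
    (l.2 = true → l.1 ≤ f v ∧ (l.1 = f v → ∃ u, f u = f v ∧ v < u))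

/-- The words all of whose letters are allowed and which have the same content as `f`. -/
def IsWord {n : ℕ} (f : Fin n → ℕ+) (w : Fin n → ℕ+ × Bool) : Prop :=
  (∀ v, LetterAllowed f v (w v)) ∧ content (fun v => (w v).1) = content f

/-- The monomial of a letter. -/
noncomputable def letterWeight (l : ℕ+ × Bool) : MvPolynomial ℕ+ (Polynomial ℚ) :=
  MvPolynomial.monomial (Finsupp.single l.1 1) (if l.2 = false then Polynomial.X else 1)

theorem prod_letterWeight {n : ℕ} (w : Fin n → ℕ+ × Bool) :
    ∏ v, letterWeight (w v) = MvPolynomial.monomial (content fun v => (w v).1)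
      (Polynomial.X ^ #{v | (w v).2 = false}) := by
  have h : ∀ l : ℕ+ × Bool, letterWeight l =
      MvPolynomial.C (if l.2 = false then Polynomial.X else 1) * MvPolynomial.monomial (Finsupp.single l.1 1) 1 := fun l => by
    rw [letterWeight, MvPolynomial.C_mul_monomial, mul_one]
  simp only [h]
  rw [prod_mul_distrib, ← map_prod, ← prod_filter, prod_const, content,
    MvPolynomial.monomial_sum_index]

theorem sum_letterWeight {n : ℕ} (f : Fin n → ℕ+) (S : Finset ℕ+) (v : Fin n) (hv : f v ∈ S) :
    ∑ l ∈ S ×ˢ univ with LetterAllowed f v l, letterWeight l =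
      letterForm S (f v) - (if ∃ u, f u = f v ∧ u < v then 0 else excVar * MvPolynomial.X (f v)) -
        (if ∃ u, f u = f v ∧ v < u then 0 else MvPolynomial.X (f v)) := by
  have hX : ∀ c, letterWeight (c, false) = excVar * MvPolynomial.X c := fun c => by
    simp [letterWeight, excVar, MvPolynomial.C_mul_X_eq_monomial]
  have h1 : ∀ c, letterWeight (c, true) = MvPolynomial.X c := fun c => by
    simp [letterWeight, MvPolynomial.X]
  rw [sum_filter, sum_product]
  simp only [Fintype.sum_bool, LetterAllowed, hX, h1, sum_add_distrib, reduceCtorEq,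
    false_imp_iff, true_imp_iff, and_true, true_and]
  rw [add_comm]
  have e1 : ∑ c ∈ S, (if f v ≤ c ∧ (c = f v → ∃ u, f u = f v ∧ u < v) then
      excVar * MvPolynomial.X c else 0) = excVar * ∑ b ∈ S with f v ≤ b, MvPolynomial.X b -
      (if ∃ u, f u = f v ∧ u < v then 0 else excVar * MvPolynomial.X (f v)) := by
    rw [mul_sum, eq_sub_iff_add_eq, sum_filter, ← add_sum_erase _ _ hv, ← add_sum_erase _ _ hv]
    have : ∀ c ∈ S.erase (f v), (if f v ≤ c ∧ (c = f v → ∃ u, f u = f v ∧ u < v) then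
        excVar * MvPolynomial.X c else 0) = if f v ≤ c then excVar * MvPolynomial.X c else 0 := by
      intro c hc
      simp [(mem_erase.1 hc).1]
    rw [sum_congr rfl this]
    by_cases h : ∃ u, f u = f v ∧ u < v
    · simp only [h, le_refl, if_true, imp_true_iff, and_self, add_zero]
    · simp only [h, le_refl, if_true, if_false, true_and, true_imp_iff]
      ring
  have e2 : ∑ c ∈ S, (if c ≤ f v ∧ (c = f v → ∃ u, f u = f v ∧ v < u) then
      MvPolynomial.X c else 0 : MvPolynomial ℕ+ (Polynomial ℚ)) =
      ∑ b ∈ S with b ≤ f v, MvPolynomial.X b -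
      (if ∃ u, f u = f v ∧ v < u then 0 else MvPolynomial.X (f v)) := by
    rw [eq_sub_iff_add_eq, sum_filter, ← add_sum_erase _ _ hv, ← add_sum_erase _ _ hv]
    have : ∀ c ∈ S.erase (f v), (if c ≤ f v ∧ (c = f v → ∃ u, f u = f v ∧ v < u) then
        MvPolynomial.X c else 0 : MvPolynomial ℕ+ (Polynomial ℚ)) =
        if c ≤ f v then MvPolynomial.X c else 0 := by
      intro c hc
      simp [(mem_erase.1 hc).1]
    rw [sum_congr rfl this]
    by_cases h : ∃ u, f u = f v ∧ v < u
    · simp only [h, le_refl, if_true, imp_true_iff, and_self, add_zero]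
    · simp only [h, le_refl, if_true, if_false, true_and, true_imp_iff]
      ring
  rw [e1, e2, letterForm]
  ring

theorem prod_sum_letterWeight {n : ℕ} (f : Fin n → ℕ+) {S : Finset ℕ+}
    (hS : (content f).support ⊆ S) :
    ∏ v, ∑ l ∈ S ×ˢ univ with LetterAllowed f v l, letterWeight l = blockPoly S (content f) := by
  have hmem : ∀ v, f v ∈ S := fun v => hS (mem_support_content f v)
  rw [blockPoly, ← prod_fiberwise_of_maps_to (g := f) (t := S) fun v _ => hmem v]
  refine prod_congr rfl fun c _ => ?_
  rw [content_apply, ← prod_endTrimmed]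
  refine prod_congr rfl fun v hv => ?_
  rw [sum_letterWeight f S v (hmem v)]
  simp only [mem_filter, mem_univ, true_and] at hv ⊢
  rw [hv]

theorem coeff_coeff_blockPoly {n : ℕ} (f : Fin n → ℕ+) {S : Finset ℕ+}
    (hS : (content f).support ⊆ S) (j : ℕ) :
    ((blockPoly S (content f)).coeff (content f)).coeff j =
      Nat.card {w // IsWord f w ∧ #{v | (w v).2 = false} = j} := by
  rw [← prod_sum_letterWeight f hS, prod_univ_sum, MvPolynomial.coeff_sum,
    Polynomial.finsetSum_coeff]
  simp only [prod_letterWeight, MvPolynomial.coeff_monomial]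
  have h : ∀ w : Fin n → ℕ+ × Bool, (if content (fun v => (w v).1) = content f then
      (Polynomial.X : Polynomial ℚ) ^ #{v | (w v).2 = false} else 0).coeff j =
      if content (fun v => (w v).1) = content f ∧ #{v | (w v).2 = false} = j then 1 else 0 := by
    intro w
    by_cases hc : content (fun v => (w v).1) = content f
    · simp only [hc, if_true, true_and, Polynomial.coeff_X_pow, eq_comm (a := j)]
    · simp [hc]
  simp only [h, sum_boole]
  rw [Nat.subtype_card]
  intro w
  simp only [IsWord, mem_filter, Fintype.mem_piFinset, mem_product, mem_univ, and_true]
  constructor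
  · rintro ⟨hw, hc, hj⟩
    exact ⟨⟨fun v => (hw v).2, hc⟩, hj⟩
  · rintro ⟨⟨hw, hc⟩, hj⟩
    refine ⟨fun v => ⟨hS ?_, hw v⟩, hc, hj⟩
    rw [← hc]
    exact mem_support_content (fun v => (w v).1) v

theorem toMultiset_content {n : ℕ} (f : Fin n → ℕ+) :
    Finsupp.toMultiset (content f) = (univ : Finset (Fin n)).val.map f := by
  simp only [content, map_sum, Finsupp.toMultiset_single, one_smul]
  rw [Finset.sum, ← Multiset.sum_map_singleton (Multiset.map f _), Multiset.map_map]
  rfl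

theorem eq_of_antitone_of_content_eq {n : ℕ} {f g : Fin n → ℕ+} (hf : Antitone f)
    (hg : Antitone g) (h : content f = content g) : f = g := by
  have h' := congrArg Finsupp.toMultiset h
  rw [toMultiset_content, toMultiset_content, Fin.univ_val_map, Fin.univ_val_map,
    Multiset.coe_eq_coe] at h'
  exact List.ofFn_injective (h'.eq_of_sortedGE hf.sortedGE_ofFn hg.sortedGE_ofFn)

theorem exists_antitone_content_eq (d : ℕ+ →₀ ℕ) :
    ∃ f : Fin d.degree → ℕ+, Antitone f ∧ content f = d := by
  obtain ⟨g, hg⟩ : ∃ g : Fin d.degree → ℕ+, content g = d := by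
    have hl : (Finsupp.toMultiset d).toList.length = d.degree := by
      rw [Multiset.length_toList, Finsupp.card_toMultiset]; rfl
    refine ⟨fun v => (Finsupp.toMultiset d).toList.get (v.cast hl.symm),
      Multiset.toFinsupp.symm.injective ?_⟩
    change Finsupp.toMultiset _ = Finsupp.toMultiset d
    rw [toMultiset_content, Fin.univ_val_map]
    conv_rhs => rw [← Multiset.coe_toList (Finsupp.toMultiset d)]
    congr 1
    apply List.ext_get <;> simp [hl]
  refine ⟨g ∘ Tuple.sort (OrderDual.toDual ∘ g), ?_, (content_comp_perm _ _).trans hg⟩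
  exact fun i j hij => Tuple.monotone_sort (OrderDual.toDual ∘ g) hij

/-- The conditions on a sequence `f` defining the terms of `Fqs n (ExdSet σ)`. -/
def ExdCompatible {n : ℕ} (f : Fin n → ℕ+) (σ : Equiv.Perm (Fin n)) : Prop :=
  ∀ j : Fin n, ∀ hj : j.val + 1 < n,
    f ⟨j.val + 1, hj⟩ ≤ f j ∧ (j.val + 1 ∈ ExdSet σ → f ⟨j.val + 1, hj⟩ < f j)

/-- Letters ordered by decreasing size, with the excedance letter before the anti-excedance one. -/
def letterKey (l : ℕ+ × Bool) : ℕ+ᵒᵈ ×ₗ Bool := toLex (OrderDual.toDual l.1, l.2)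

theorem pv_succ {n : ℕ} (σ : Equiv.Perm (Fin n)) (i : Fin n) : pv σ (i + 1) = σ i + 1 := by
  simp [pv]

theorem exc_eq_card {n : ℕ} (σ : Equiv.Perm (Fin n)) : exc σ = #{i | i < σ i} := by
  symm
  rw [exc, ExcSet]
  refine card_bij (fun i _ => (i : ℕ) + 1) ?_ ?_ ?_
  · intro i hi
    have h : i < σ i := by simpa using hi
    rw [mem_filter, mem_Icc, pv_succ]
    have := (σ i).isLt
    omega
  · intro i _ k _ h
    exact Fin.ext (by omega)
  · intro k hk
    rw [mem_filter, mem_Icc] at hk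
    have hpv := pv_succ σ ⟨k - 1, by omega⟩
    simp only [Nat.sub_add_cancel hk.1.1] at hpv
    refine ⟨⟨k - 1, by omega⟩, ?_, by simp only; omega⟩
    rw [mem_filter, Fin.lt_def]
    exact ⟨mem_univ _, by simp only; omega⟩

theorem exdCompatible_iff_strictMono {n : ℕ} (f : Fin n → ℕ+) (σ : Equiv.Perm (Fin n)) :
    ExdCompatible f σ ↔
      StrictMono fun i => toLex (letterKey (f i, decide (σ i ≤ i)), σ i) := by
  obtain _ | n := n
  · exact ⟨fun _ i => i.elim0, fun _ i => i.elim0⟩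
  have key : ∀ i : Fin n, (toLex (letterKey (f i.castSucc, decide (σ i.castSucc ≤ i.castSucc)),
      σ i.castSucc) < toLex (letterKey (f i.succ, decide (σ i.succ ≤ i.succ)), σ i.succ)) ↔
      f i.succ ≤ f i.castSucc ∧ ((i : ℕ) + 1 ∈ ExdSet σ → f i.succ < f i.castSucc) := by
    intro i
    have hne : (σ i.castSucc : ℕ) ≠ σ i.succ := fun h =>
      (Fin.castSucc_lt_succ (i := i)).ne (σ.injective (Fin.ext h))
    have h1 := pv_succ σ i.castSucc
    have h2 := pv_succ σ i.succ
    simp only [Fin.val_castSucc, Fin.val_succ] at h1 h2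
    have hi := i.isLt
    simp only [ExdSet, mem_filter, mem_Icc, h1, h2, letterKey, Prod.Lex.toLex_lt_toLex,
      OrderDual.toDual_lt_toDual, EmbeddingLike.apply_eq_iff_eq, Prod.mk.injEq, Fin.le_def,
      Fin.lt_def, Fin.val_castSucc, Fin.val_succ, Bool.lt_iff, decide_eq_false_iff_not,
      decide_eq_true_eq, decide_eq_decide]
    rcases lt_trichotomy (f i.succ) (f i.castSucc) with h | h | h
    · simp [h, h.le]
    · simp only [h, lt_irrefl, le_refl, false_or, true_and, imp_false]
      omega
    · simp [h.not_ge, h.not_gt, h.ne]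
  rw [Fin.strictMono_iff_lt_succ]
  simp only [key]
  constructor
  · exact fun h i => h i.castSucc (by simp)
  · intro h i hi
    exact h ⟨i, by omega⟩

theorem strictMono_toLex_iff {ι α β : Type*} [LinearOrder ι] [LinearOrder α] [LinearOrder β]
    (g : ι → α) (s : ι → β) :
    StrictMono (fun i => toLex (g i, s i)) ↔
      Monotone g ∧ ∀ i j, i < j → g i = g j → s i < s j := by
  simp only [StrictMono, Prod.Lex.toLex_lt_toLex, monotone_iff_forall_lt]
  constructor
  · refine fun h => ⟨fun i j hij => ?_, fun i j hij he => ?_⟩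
    · exact (h hij).elim le_of_lt fun h => h.1.le
    · exact (h hij).elim (fun h => absurd he h.ne) fun h => h.2
  · rintro ⟨h1, h2⟩ i j hij
    exact (h1 hij).lt_or_eq.imp id fun he => ⟨he, h2 i j hij he⟩

/-- The word of a permutation: its `v`-th letter records the entry of `f` at the position of `v`
and whether that position is an excedance. -/
def wordOf {n : ℕ} (f : Fin n → ℕ+) (σ : Equiv.Perm (Fin n)) (v : Fin n) : ℕ+ × Bool :=
  (f (σ.symm v), decide (v ≤ σ.symm v))

theorem exdCompatible_iff_eq_sort {n : ℕ} (f : Fin n → ℕ+) (σ : Equiv.Perm (Fin n)) :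
    ExdCompatible f σ ↔ σ = Tuple.sort (letterKey ∘ wordOf f σ) := by
  rw [exdCompatible_iff_strictMono, strictMono_toLex_iff, Tuple.eq_sort_iff]
  simp [Function.comp_def, wordOf]

theorem isWord_wordOf {n : ℕ} {f : Fin n → ℕ+} (hf : Antitone f) {σ : Equiv.Perm (Fin n)}
    (hσ : ∀ i, σ i ≠ i) : IsWord f (wordOf f σ) := by
  refine ⟨fun v => ⟨fun h => ?_, fun h => ?_⟩, content_comp_perm f σ.symm⟩
  · have hlt : σ.symm v < v := by simpa [wordOf] using h
    exact ⟨hf hlt.le, fun he => ⟨_, he, hlt⟩⟩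
  · have hle : v ≤ σ.symm v := by simpa [wordOf] using h
    have hne : v ≠ σ.symm v := fun h => hσ v (by rw [σ.eq_symm_apply] at h; exact h)
    exact ⟨hf hle, fun he => ⟨_, he, lt_of_le_of_ne hle hne⟩⟩

theorem card_false_wordOf {n : ℕ} (f : Fin n → ℕ+) (σ : Equiv.Perm (Fin n)) :
    #{v | (wordOf f σ v).2 = false} = exc σ := by
  rw [exc_eq_card]
  symm
  refine card_equiv σ fun i => ?_
  simp [wordOf]

section Inverse

variable {n : ℕ} {f : Fin n → ℕ+} {w : Fin n → ℕ+ × Bool}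

theorem fst_word_sort (hf : Antitone f) (hw : IsWord f w) (i : Fin n) :
    (w (Tuple.sort (letterKey ∘ w) i)).1 = f i := by
  have hg : Antitone fun i => (w (Tuple.sort (letterKey ∘ w) i)).1 := fun i k hik =>
    
    OrderDual.toDual_le_toDual.1
      (Prod.Lex.monotone_fst _ _ (Tuple.monotone_sort (letterKey ∘ w) hik))
  refine congrFun (eq_of_antitone_of_content_eq hg hf ?_) i
  rw [← hw.2]
  exact content_comp_perm (fun v => (w v).1) _

theorem sort_lt_sort_of_eq {i k : Fin n} (hik : i < k)
    (h : w (Tuple.sort (letterKey ∘ w) i) = w (Tuple.sort (letterKey ∘ w) k)) :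
    Tuple.sort (letterKey ∘ w) i < Tuple.sort (letterKey ∘ w) k :=
  (Tuple.eq_sort_iff.1 rfl).2 i k hik (congrArg letterKey h)

theorem lt_sort_of_snd_eq_false (hf : Antitone f) (hw : IsWord f w) {i : Fin n}
    (hi : (w (Tuple.sort (letterKey ∘ w) i)).2 = false) :
    i < Tuple.sort (letterKey ∘ w) i := by
  set σ := Tuple.sort (letterKey ∘ w) with hσ
  have hfst : ∀ i, (w (σ i)).1 = f i := fst_word_sort hf hw
  by_contra! hle
  obtain ⟨h1, h2⟩ := (hw.1 (σ i)).1 hi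
  rw [hfst] at h1 h2
  have heq : f (σ i) = f i := le_antisymm h1 (hf hle)
  have hne : (univ.filter fun u => f u = f i).Nonempty := ⟨i, by simp⟩
  obtain ⟨P, hP, hmin⟩ : ∃ P, f P = f i ∧ ∀ u, f u = f i → P ≤ u :=
    ⟨_, (mem_filter.1 (min'_mem _ hne)).2, fun u hu => min'_le _ u (by simpa using hu)⟩
  have hword : ∀ k ∈ Icc P i, w (σ k) = (f i, false) := by
    intro k hk
    rw [mem_Icc] at hk
    have hfk : f k = f i := le_antisymm (hP ▸ hf hk.1) (hf hk.2)
    have hmono := Tuple.monotone_sort (letterKey ∘ w) hk.2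
    simp only [Function.comp_apply, ← hσ, letterKey, Prod.Lex.toLex_le_toLex, hfst, hfk, hi,
      lt_irrefl, false_or, true_and] at hmono
    exact Prod.ext (by rw [hfst, hfk]) (Bool.eq_false_of_le_false hmono)
  have hmaps : ∀ k ∈ Icc P i, σ k ∈ Ioc P (σ i) := by
    intro k hk
    have hwk := hword k hk
    rw [mem_Icc] at hk
    have hle : σ k ≤ σ i := by
      rcases hk.2.eq_or_lt with rfl | hlt
      · exact le_rfl
      · exact (sort_lt_sort_of_eq hlt (hwk.trans (hword i (by simp [hmin i rfl])).symm)).le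
    obtain ⟨h3, h4⟩ := (hw.1 (σ k)).1 (by rw [hwk])
    rw [hwk] at h3 h4
    have hfσ : f i = f (σ k) := le_antisymm (heq ▸ hf hle) h3
    obtain ⟨u, hu, hlt⟩ := h4 hfσ
    exact mem_Ioc.2 ⟨(hmin u (hu.trans hfσ.symm)).trans_lt hlt, hle⟩
  have hcard := card_le_card_of_injOn σ hmaps σ.injective.injOn
  rw [Fin.card_Icc, Fin.card_Ioc] at hcard
  have := hmin i rfl
  rw [Fin.le_def] at hle this
  omega

theorem sort_lt_of_snd_eq_true (hf : Antitone f) (hw : IsWord f w) {i : Fin n}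
    (hi : (w (Tuple.sort (letterKey ∘ w) i)).2 = true) :
    Tuple.sort (letterKey ∘ w) i < i := by
  set σ := Tuple.sort (letterKey ∘ w) with hσ
  have hfst : ∀ i, (w (σ i)).1 = f i := fst_word_sort hf hw
  by_contra! hle
  obtain ⟨h1, h2⟩ := (hw.1 (σ i)).2 hi
  rw [hfst] at h1 h2
  have heq : f (σ i) = f i := le_antisymm (hf hle) h1
  have hne : (univ.filter fun u => f u = f i).Nonempty := ⟨i, by simp⟩
  obtain ⟨Z, hZ, hmax⟩ : ∃ Z, f Z = f i ∧ ∀ u, f u = f i → u ≤ Z :=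
    ⟨_, (mem_filter.1 (max'_mem _ hne)).2, fun u hu => le_max' _ u (by simpa using hu)⟩
  have hword : ∀ k ∈ Icc i Z, w (σ k) = (f i, true) := by
    intro k hk
    rw [mem_Icc] at hk
    have hfk : f k = f i := le_antisymm (hf hk.1) (hZ ▸ hf hk.2)
    have hmono := Tuple.monotone_sort (letterKey ∘ w) hk.1
    simp only [Function.comp_apply, ← hσ, letterKey, Prod.Lex.toLex_le_toLex, hfst, hfk, hi,
      lt_irrefl, false_or, true_and] at hmono
    exact Prod.ext (by rw [hfst, hfk]) (Bool.eq_true_of_true_le hmono)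
  have hmaps : ∀ k ∈ Icc i Z, σ k ∈ Ico (σ i) Z := by
    intro k hk
    have hwk := hword k hk
    rw [mem_Icc] at hk
    have hle : σ i ≤ σ k := by
      rcases hk.1.eq_or_lt with rfl | hlt
      · exact le_rfl
      · exact (sort_lt_sort_of_eq hlt ((hword i (by simp [hmax i rfl])).trans hwk.symm)).le
    obtain ⟨h3, h4⟩ := (hw.1 (σ k)).2 (by rw [hwk])
    rw [hwk] at h3 h4
    have hfσ : f i = f (σ k) := le_antisymm h3 (heq ▸ hf hle)
    obtain ⟨u, hu, hlt⟩ := h4 hfσ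
    exact mem_Ico.2 ⟨hle, hlt.trans_le (hmax u (hu.trans hfσ.symm))⟩
  have hcard := card_le_card_of_injOn σ hmaps σ.injective.injOn
  rw [Fin.card_Icc, Fin.card_Ico] at hcard
  have := hmax i rfl
  rw [Fin.le_def] at hle this
  omega

theorem wordOf_sort (hf : Antitone f) (hw : IsWord f w) :
    wordOf f (Tuple.sort (letterKey ∘ w)) = w := by
  funext v
  obtain ⟨i, rfl⟩ := (Tuple.sort (letterKey ∘ w)).surjective v
  refine Prod.ext (by simp [wordOf, fst_word_sort hf hw]) ?_
  rcases h : (w (Tuple.sort (letterKey ∘ w) i)).2 with _ | _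
  · simpa [wordOf] using lt_sort_of_snd_eq_false hf hw h
  · simpa [wordOf] using (sort_lt_of_snd_eq_true hf hw h).le

theorem sort_ne_self (hf : Antitone f) (hw : IsWord f w) (i : Fin n) :
    Tuple.sort (letterKey ∘ w) i ≠ i := by
  rcases h : (w (Tuple.sort (letterKey ∘ w) i)).2 with _ | _
  · exact (lt_sort_of_snd_eq_false hf hw h).ne'
  · exact (sort_lt_of_snd_eq_true hf hw h).ne

end Inverse

theorem card_exdCompatible {n : ℕ} {f : Fin n → ℕ+} (hf : Antitone f) (j : ℕ) :
    Nat.card {σ : Equiv.Perm (Fin n) // ((∀ i, σ i ≠ i) ∧ exc σ = j) ∧ ExdCompatible f σ} =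
      Nat.card {w // IsWord f w ∧ #{v | (w v).2 = false} = j} := by
  refine Nat.card_congr ⟨
    fun σ => ⟨wordOf f σ, isWord_wordOf hf σ.2.1.1, (card_false_wordOf f σ).trans σ.2.1.2⟩,
    fun w => ⟨Tuple.sort (letterKey ∘ w.1), ⟨sort_ne_self hf w.2.1, ?_⟩, ?_⟩, ?_, ?_⟩
  · rw [← card_false_wordOf f, wordOf_sort hf w.2.1, w.2.2]
  · rw [exdCompatible_iff_eq_sort, wordOf_sort hf w.2.1]
  · exact fun σ => Subtype.ext ((exdCompatible_iff_eq_sort f σ).1 σ.2.2).symm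
  · exact fun w => Subtype.ext (wordOf_sort hf w.2.1)

theorem ExdCompatible.antitone {n : ℕ} {f : Fin n → ℕ+} {σ : Equiv.Perm (Fin n)}
    (h : ExdCompatible f σ) : Antitone f := by
  obtain _ | n := n
  · exact fun i => i.elim0
  · exact Fin.antitone_iff_succ_le.2 fun i => (h i.castSucc (by simp)).1

theorem coeff_Fqs {n : ℕ} (σ : Equiv.Perm (Fin n)) {f : Fin n → ℕ+} (hf : Antitone f) :
    MvPowerSeries.coeff (content f) (Fqs n (ExdSet σ)) = if ExdCompatible f σ then 1 else 0 := by
  have h : MvPowerSeries.coeff (content f) (Fqs n (ExdSet σ)) =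
      (Nat.card {g : Fin n → ℕ+ // ExdCompatible g σ ∧ content g = content f} : ℚ) := by
    simp only [content_eq_iff]
    rfl
  rw [h, Nat.subtype_card (if ExdCompatible f σ then {f} else ∅)]
  · split_ifs <;> simp
  · intro g
    split_ifs with hc
    · rw [mem_singleton]
      exact ⟨by rintro rfl; exact ⟨hc, rfl⟩,
        fun hg => eq_of_antitone_of_content_eq hg.1.antitone hf hg.2⟩
    · simp only [notMem_empty, false_iff, not_and]
      intro hg he
      exact hc (eq_of_antitone_of_content_eq hg.antitone hf he ▸ hg)

theorem coeff_Qtilde_of_degree_ne {n : ℕ} (j : ℕ) {d : ℕ+ →₀ ℕ} (hd : d.degree ≠ n) :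
    MvPowerSeries.coeff d (Qtilde n j) = 0 := by
  rw [Qtilde, map_sum]
  refine sum_eq_zero fun σ _ => ?_
  have h : MvPowerSeries.coeff d (Fqs n (ExdSet σ)) =
      (Nat.card {g : Fin n → ℕ+ // ExdCompatible g σ ∧ content g = d} : ℚ) := by
    simp only [content_eq_iff]
    rfl
  have : IsEmpty {g : Fin n → ℕ+ // ExdCompatible g σ ∧ content g = d} :=
    ⟨fun g => hd (g.2.2 ▸ degree_content g.1)⟩
  rw [h, Nat.card_of_isEmpty, Nat.cast_zero]

theorem coeff_Qtilde_degree (j : ℕ) (d : ℕ+ →₀ ℕ) {S : Finset ℕ+} (hS : d.support ⊆ S) :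
    MvPowerSeries.coeff d (Qtilde d.degree j) = ((blockPoly S d).coeff d).coeff j := by
  obtain ⟨f, hf, hd⟩ := exists_antitone_content_eq d
  have h := coeff_coeff_blockPoly f (S := S) (by rwa [hd]) j
  have h2 : ∀ σ, MvPowerSeries.coeff d (Fqs d.degree (ExdSet σ)) =
      if ExdCompatible f σ then 1 else 0 := fun σ => by rw [← coeff_Fqs σ hf, hd]
  rw [hd, ← card_exdCompatible hf] at h
  rw [h, Qtilde, map_sum, sum_congr rfl fun σ _ => h2 σ, sum_boole, filter_filter,
    Nat.subtype_card]
  simp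

theorem sum_range_filter_eq_coeff (D : Polynomial ℚ) (j m b n : ℕ) (hn : m + b = n) :
    ∑ i ∈ (range j).filter (fun i => j + m < i + n), D.coeff i =
      ((∑ k ∈ Ico 1 b, Polynomial.X ^ k) * D).coeff j := by
  have h : ∀ k, (Polynomial.X ^ k * D).coeff j = if k ≤ j then D.coeff (j - k) else 0 :=
    fun k => Polynomial.coeff_X_pow_mul' D k j
  rw [sum_mul, Polynomial.finsetSum_coeff, sum_congr rfl fun k _ => h k, ← sum_filter]
  refine sum_nbij' (fun i => j - i) (fun k => j - k) ?_ ?_ ?_ ?_ ?_ <;>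
    simp only [mem_filter, mem_range, mem_Ico]
  · omega
  · omega
  · omega
  · omega
  · intro i hi
    rw [show j - (j - i) = i by omega]

theorem Qtilde_recurrence (n j : ℕ) (hn : 1 ≤ n) :
    Qtilde n j =
      ∑ m ∈ Finset.range (n - 1),
        ∑ i ∈ (Finset.range j).filter (fun i => j + m < i + n),
          Qtilde m i * hSym (n - m) := by
  ext d
  have hcoeff : ∀ m i, MvPowerSeries.coeff d (Qtilde m i * hSym (n - m)) =
      ∑ u ∈ antidiagonal d, if u.2.degree = m ∧ u.1.degree = n - m then
        ((blockPoly d.support u.2).coeff u.2).coeff i else 0 := by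
    intro m i
    rw [mul_comm, MvPowerSeries.coeff_mul]
    refine sum_congr rfl fun u hu => ?_
    rw [HasAntidiagonal.mem_antidiagonal] at hu
    have hsub : u.2.support ⊆ d.support := Finsupp.support_mono (hu ▸ le_add_self)
    have hh : MvPowerSeries.coeff u.1 (hSym (n - m)) =
        if u.1.degree = n - m then 1 else 0 := rfl
    rw [hh]
    by_cases h2 : u.2.degree = m
    · subst h2
      simp [coeff_Qtilde_degree i u.2 hsub]
    · simp [coeff_Qtilde_of_degree_ne i h2, h2]
  simp only [map_sum, hcoeff]
  by_cases hd : d.degree = n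
  · have hd0 : d ≠ 0 := by
      rintro rfl
      simp at hd
      omega
    have hQ := coeff_Qtilde_degree j d subset_rfl
    rw [hd] at hQ
    rw [hQ, coeff_blockPoly_recurrence hd0, Polynomial.finsetSum_coeff]
    have hswap : ∀ m, ∑ i ∈ (range j).filter (fun i => j + m < i + n), ∑ u ∈ antidiagonal d,
        (if u.2.degree = m ∧ u.1.degree = n - m then
          ((blockPoly d.support u.2).coeff u.2).coeff i else 0) =
        ∑ u ∈ antidiagonal d, ∑ i ∈ (range j).filter (fun i => j + m < i + n),
        (if u.2.degree = m ∧ u.1.degree = n - m then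
          ((blockPoly d.support u.2).coeff u.2).coeff i else 0) := fun m => sum_comm
    simp only [hswap]
    rw [sum_comm]
    refine sum_congr rfl fun u hu => ?_
    rw [HasAntidiagonal.mem_antidiagonal] at hu
    have hdeg : u.2.degree + u.1.degree = n := by rw [← hd, ← hu, map_add, add_comm]
    rw [← sum_range_filter_eq_coeff _ j _ _ n hdeg]
    by_cases hm : u.2.degree ∈ range (n - 1)
    · rw [sum_eq_single_of_mem _ hm]
      · simp [show u.1.degree = n - u.2.degree by omega]
      · intro m _ hne
        simp [hne.symm]
    · rw [mem_range] at hm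
      rw [filter_eq_empty_iff.2 fun i hi => by rw [mem_range] at hi; omega, sum_empty, eq_comm]
      refine sum_eq_zero fun m hmem => sum_eq_zero fun i _ => if_neg fun h => hm ?_
      rw [h.1]
      exact mem_range.1 hmem
  · rw [coeff_Qtilde_of_degree_ne j hd, eq_comm]
    refine sum_eq_zero fun m hm => sum_eq_zero fun i _ => sum_eq_zero fun u hu => if_neg ?_
    rintro ⟨h1, h2⟩
    rw [HasAntidiagonal.mem_antidiagonal] at hu
    rw [mem_range] at hm
    apply hd
    rw [← hu, map_add, h1, h2]
    omega
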